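/- Theorem 1, part 1 (attack detection over ℤ_q): For any ε > 0 there exist s1' > 0 and s2' > 0 such that for all scale factors s1 < s1', s2 < s2' and every modulus q ∈ ℕ with q > 2(κ(M + 2·z̃_ini) + 2ε)/(s1²·s2), the following holds: if the inequality ‖s1²·s2·r̄(t)‖ ≤ 2κ·z̃_ini·1_{t<l_max} + ε is violated for some t ≥ 0, then I ≠ [p], i.e., the attack signal a is not identically zero. -/

import Mathlib

open Matrix

/-- Infinity norm of a finite-dimensional real vector. -/
noncomputable def vnorm {ι : Type*} (v : ι → ℝ) : ℝ := sSup (Set.range fun i => |v i|)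

/-- Operator norm of a real matrix induced by the infinity-norm on vectors. -/
noncomputable def mnorm {ι κ : Type*} [Fintype κ] (A : Matrix ι κ ℝ) : ℝ :=
  sSup (Set.range fun i => ∑ j, |A i j|)

/-- Centered modulo: maps `ℤ` onto `ℤ_q = ℤ ∩ [-q/2, q/2)`. -/
def cmod (a : ℤ) (q : ℕ) : ℤ := (a + (q : ℤ) / 2) % (q : ℤ) - (q : ℤ) / 2

/-- Componentwise centered modulo. -/
def cmodv {ι : Type*} (v : ι → ℤ) (q : ℕ) : ι → ℤ := fun i => cmod (v i) q

/-- Componentwise rounding of a real vector to the nearest integer. -/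
noncomputable def roundVec {ι : Type*} (v : ι → ℝ) : ι → ℤ := fun i => round (v i)

/-- Componentwise rounding of a real matrix to the nearest integer. -/
noncomputable def roundMat {ι κ : Type*} (A : Matrix ι κ ℝ) : Matrix ι κ ℤ :=
  Matrix.of fun i j => round (A i j)

/-- The `d × d` lower-shift matrix (ones on the first subdiagonal), real version. -/
def shiftM (d : ℕ) : Matrix (Fin d) (Fin d) ℝ :=
  Matrix.of fun r c => if (r : ℕ) = (c : ℕ) + 1 then (1 : ℝ) else 0

/-- The observable-canonical-form state matrix `Fᵢ`. -/
def canonF {d : ℕ} (f : Fin d → ℝ) : Matrix (Fin d) (Fin d) ℝ :=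
  Matrix.of fun r c =>
    (if (r : ℕ) = (c : ℕ) + 1 then (1 : ℝ) else 0) + (if (c : ℕ) = d - 1 then f r else 0)

/-- The block-diagonal stacked lower-shift matrix `F̄ = diag(F̄_1, …, F̄_p)` (over `ℤ`). -/
def sigmaShift {p : ℕ} (li : Fin p → ℕ) :
    Matrix (Σ i : Fin p, Fin (li i)) (Σ i : Fin p, Fin (li i)) ℤ :=
  Matrix.of fun j j' => if j.1 = j'.1 ∧ (j.2 : ℕ) = (j'.2 : ℕ) + 1 then 1 else 0

/-- The stacked real input matrix `[Φ B, L]` of the observer (block row `i` is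
`[Φ_i B, 0 ⋯ L_i ⋯ 0]` with `L_i = f_i` in column `i` of the output part). -/
def Gmat {n m p : ℕ} (li : Fin p → ℕ)
    (Φ : (i : Fin p) → Matrix (Fin (li i)) (Fin n) ℝ)
    (B : Matrix (Fin n) (Fin m) ℝ) (fc : (i : Fin p) → Fin (li i) → ℝ) :
    Matrix (Σ i : Fin p, Fin (li i)) (Fin m ⊕ Fin p) ℝ :=
  Matrix.of fun j c =>
    Sum.elim (fun cm => (Φ j.1 * B) j.2 cm)
      (fun cp => if cp = j.1 then fc j.1 j.2 else 0) c

section Norms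

variable {ι κ : Type*} [Finite ι]

theorem abs_le_vnorm (v : ι → ℝ) (i : ι) : |v i| ≤ vnorm v :=
  le_csSup (Set.finite_range fun i => |v i|).bddAbove ⟨i, rfl⟩

theorem sum_abs_le_mnorm [Fintype κ] (A : Matrix ι κ ℝ) (i : ι) : ∑ j, |A i j| ≤ mnorm A :=
  le_csSup (Set.finite_range fun i => ∑ j, |A i j|).bddAbove ⟨i, rfl⟩

theorem abs_le_mnorm [Fintype κ] (A : Matrix ι κ ℝ) (i : ι) (j : κ) : |A i j| ≤ mnorm A :=
  (Finset.single_le_sum (f := fun j => |A i j|) (fun _ _ => abs_nonneg _)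
    (Finset.mem_univ j)).trans (sum_abs_le_mnorm A i)

theorem abs_mulVec_le [Fintype κ] (A : Matrix ι κ ℝ) {w : κ → ℝ} {b : ℝ}
    (hb : 0 ≤ b) (hw : ∀ j, |w j| ≤ b) (i : ι) : |(A *ᵥ w) i| ≤ mnorm A * b := by
  calc |(A *ᵥ w) i| ≤ ∑ j, |A i j * w j| := Finset.abs_sum_le_sum_abs _ _
    _ ≤ ∑ j, |A i j| * b := Finset.sum_le_sum fun j _ => by
        rw [abs_mul]; exact mul_le_mul_of_nonneg_left (hw j) (abs_nonneg _)
    _ = (∑ j, |A i j|) * b := (Finset.sum_mul _ _ _).symm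
    _ ≤ mnorm A * b := mul_le_mul_of_nonneg_right (sum_abs_le_mnorm A i) hb

end Norms

theorem vnorm_nonneg {ι : Type*} (v : ι → ℝ) : 0 ≤ vnorm v :=
  Real.sSup_nonneg (by rintro _ ⟨i, rfl⟩; exact abs_nonneg _)

theorem mnorm_nonneg {ι κ : Type*} [Fintype κ] (A : Matrix ι κ ℝ) : 0 ≤ mnorm A :=
  Real.sSup_nonneg (by rintro _ ⟨i, rfl⟩; exact Finset.sum_nonneg fun _ _ => abs_nonneg _)

theorem vnorm_le {ι : Type*} {v : ι → ℝ} {b : ℝ} (hb : 0 ≤ b) (h : ∀ i, |v i| ≤ b) :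
    vnorm v ≤ b :=
  Real.sSup_le (by rintro _ ⟨i, rfl⟩; exact h i) hb

section CenteredModulo

theorem cmod_modEq (a : ℤ) (q : ℕ) : cmod a q ≡ a [ZMOD q] := by
  have h := (Int.mod_modEq (a + (q : ℤ) / 2) q).sub_right ((q : ℤ) / 2)
  simpa [cmod] using h

theorem cmod_eq_of_modEq {a b : ℤ} {q : ℕ} (h : a ≡ b [ZMOD q]) (hb : 2 * |b| < q) :
    cmod a q = b := by
  have h1 : (a + (q : ℤ) / 2) % q = (b + (q : ℤ) / 2) % q := h.add_right _
  have h2 := neg_abs_le b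
  have h3 := le_abs_self b
  rw [cmod, h1, Int.emod_eq_of_lt (by omega) (by omega)]
  ring

theorem mulVec_modEq {ι κ : Type*} [Fintype κ] (W : Matrix ι κ ℤ) {v w : κ → ℤ} {q : ℤ}
    (h : ∀ j, v j ≡ w j [ZMOD q]) (i : ι) : (W *ᵥ v) i ≡ (W *ᵥ w) i [ZMOD q] :=
  Int.ModEq.sum fun j _ => (h j).mul_left _

/-- The state trajectory of `z(t+1) = S z(t) + w(t)` over `ℤ`, without modular reduction. -/
def integerState {ι : Type*} [Fintype ι] (S : Matrix ι ι ℤ) (z₀ : ι → ℤ) (w : ℕ → ι → ℤ) :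
    ℕ → ι → ℤ
  | 0 => z₀
  | t + 1 => S *ᵥ integerState S z₀ w t + w t

theorem modEq_integerState {ι : Type*} [Fintype ι] {S : Matrix ι ι ℤ} {z₀ : ι → ℤ}
    {w z : ℕ → ι → ℤ} {q : ℕ} (h0 : z 0 = cmodv z₀ q)
    (hz : ∀ t, z (t + 1) = cmodv (S *ᵥ z t + w t) q) (t : ℕ) (i : ι) :
    z t i ≡ integerState S z₀ w t i [ZMOD q] := by
  induction t generalizing i with
  | zero => rw [h0]; exact cmod_modEq _ _
  | succ t ih =>
    rw [hz]
    exact (cmod_modEq _ _).trans ((mulVec_modEq S ih i).add_right _)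

end CenteredModulo

section Quantization

theorem abs_mul_round_div_sub_le {s : ℝ} (hs : 0 < s) (w : ℝ) :
    |s * (round (w / s) : ℝ) - w| ≤ s := by
  have h := abs_sub_round (w / s)
  have h1 : s * (round (w / s) : ℝ) - w = -(s * (w / s - round (w / s))) := by
    field_simp; ring
  rw [h1, abs_neg, abs_mul, abs_of_pos hs]
  nlinarith

theorem abs_mulVec_sub_mulVec_le {ι κ : Type*} [Fintype κ] {W W' : Matrix ι κ ℝ}
    {v v' : κ → ℝ} {g b η β : ℝ} (hη : 0 ≤ η)
    (hW : ∀ i j, |W i j| ≤ g) (hv : ∀ j, |v j| ≤ b)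
    (hW' : ∀ i j, |W' i j - W i j| ≤ η) (hv' : ∀ j, |v' j - v j| ≤ β) (i : ι) :
    |(W' *ᵥ v') i - (W *ᵥ v) i| ≤ Fintype.card κ * ((g + η) * β + η * b) := by
  have key : ∀ j, |W' i j * v' j - W i j * v j| ≤ (g + η) * β + η * b := fun j => by
    have h1 : |W' i j| ≤ g + η := by
      have := abs_add_le (W' i j - W i j) (W i j)
      rw [sub_add_cancel] at this
      linarith [hW i j, hW' i j]
    calc |W' i j * v' j - W i j * v j|
        = |W' i j * (v' j - v j) + (W' i j - W i j) * v j| := by ring_nf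
      _ ≤ |W' i j| * |v' j - v j| + |W' i j - W i j| * |v j| := by
          rw [← abs_mul, ← abs_mul]; exact abs_add_le _ _
      _ ≤ (g + η) * β + η * b :=
          add_le_add (mul_le_mul h1 (hv' j) (abs_nonneg _) ((abs_nonneg _).trans h1))
            (mul_le_mul (hW' i j) (hv j) (abs_nonneg _) hη)
  calc |(W' *ᵥ v') i - (W *ᵥ v) i| = |∑ j, (W' i j * v' j - W i j * v j)| := by
        rw [Finset.sum_sub_distrib]; rfl
    _ ≤ ∑ j, |W' i j * v' j - W i j * v j| := Finset.abs_sum_le_sum_abs _ _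
    _ ≤ ∑ _j : κ, ((g + η) * β + η * b) := Finset.sum_le_sum fun j _ => key j
    _ = _ := by rw [Finset.sum_const, Finset.card_univ, nsmul_eq_mul]

/-- Scaling the integer product of a quantized matrix with an integer vector back to the reals. -/
theorem cast_roundMat_mulVec {ι κ : Type*} [Fintype κ] (W : Matrix ι κ ℝ) (s c : ℝ)
    (v : κ → ℤ) (i : ι) :
    s * c * (((roundMat fun i j => W i j / s) *ᵥ v) i : ℝ) =
      ((Matrix.of fun i j => s * (round (W i j / s) : ℝ)) *ᵥ fun j => c * (v j : ℝ)) i := by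
  simp only [Matrix.mulVec, dotProduct, roundMat, Matrix.of_apply]
  push_cast
  rw [Finset.mul_sum]
  exact Finset.sum_congr rfl fun j _ => by ring

end Quantization

section Shift

theorem shiftM_mulVec_apply {d : ℕ} (v : Fin d → ℝ) (r : Fin d) :
    (shiftM d *ᵥ v) r =
      if 0 < (r : ℕ) then v ⟨r - 1, (Nat.sub_le _ _).trans_lt r.2⟩ else 0 := by
  simp only [Matrix.mulVec, dotProduct, shiftM, Matrix.of_apply, ite_mul, one_mul, zero_mul]
  split_ifs with h
  · rw [Finset.sum_eq_single ⟨r - 1, (Nat.sub_le _ _).trans_lt r.2⟩]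
    · rw [if_pos (by simp only; omega)]
    · intro s _ hs
      refine if_neg fun h' => hs (Fin.ext ?_)
      simp only; omega
    · simp
  · exact Finset.sum_eq_zero fun s _ => if_neg (by omega)

theorem cast_sigmaShift_mulVec {p : ℕ} (li : Fin p → ℕ) (z : (Σ i : Fin p, Fin (li i)) → ℤ)
    (i : Fin p) (r : Fin (li i)) :
    ((sigmaShift li *ᵥ z) ⟨i, r⟩ : ℝ) = (shiftM (li i) *ᵥ fun s => (z ⟨i, s⟩ : ℝ)) r := by
  simp only [Matrix.mulVec, dotProduct, sigmaShift, shiftM, Matrix.of_apply, Fintype.sum_sigma]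
  rw [Finset.sum_eq_single i]
  · push_cast
    simp
  · intro i' _ hi'
    exact Finset.sum_eq_zero fun s _ => by simp [hi'.symm]
  · simp

theorem shift_trajectory_abs_le {d : ℕ} {e w : ℕ → Fin d → ℝ} {b δ : ℝ} (hb : 0 ≤ b)
    (he : ∀ t r, e (t + 1) r = (shiftM d *ᵥ e t) r + w t r)
    (h0 : ∀ r, |e 0 r| ≤ b) (hw : ∀ t r, |w t r| ≤ δ) (t : ℕ) (r : Fin d) :
    |e t r| ≤ b + (r + 1) * δ := by
  have hδ : 0 ≤ δ := (abs_nonneg _).trans (hw 0 r)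
  induction t generalizing r with
  | zero => nlinarith [h0 r, (Nat.cast_nonneg r : (0 : ℝ) ≤ ((r : ℕ) : ℝ))]
  | succ t ih =>
    rw [he, shiftM_mulVec_apply]
    have h1 := hw t r
    split_ifs with hr
    · have h2 := ih ⟨r - 1, (Nat.sub_le _ _).trans_lt r.2⟩
      simp only [Nat.cast_sub (Nat.one_le_iff_ne_zero.2 hr.ne'), Nat.cast_one] at h2
      refine (abs_add_le _ _).trans ?_
      linarith
    · rw [zero_add]
      nlinarith [(Nat.cast_nonneg r : (0 : ℝ) ≤ ((r : ℕ) : ℝ))]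

theorem shift_trajectory_eq_zero {d : ℕ} {e : ℕ → Fin d → ℝ}
    (he : ∀ t r, e (t + 1) r = (shiftM d *ᵥ e t) r) (t : ℕ) (r : Fin d) (hr : (r : ℕ) < t) :
    e t r = 0 := by
  induction t generalizing r with
  | zero => omega
  | succ t ih =>
    rw [he, shiftM_mulVec_apply]
    split_ifs with h
    · exact ih _ (by simp only; omega)
    · rfl

theorem canonF_mulVec {d : ℕ} (hd : 0 < d) (f v : Fin d → ℝ) :
    canonF f *ᵥ v = shiftM d *ᵥ v + v ⟨d - 1, Nat.sub_lt hd Nat.one_pos⟩ • f := by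
  ext r
  simp only [Matrix.mulVec, dotProduct, canonF, shiftM, Matrix.of_apply, add_mul,
    Finset.sum_add_distrib, Pi.add_apply, Pi.smul_apply, smul_eq_mul]
  congr 1
  rw [Finset.sum_eq_single ⟨d - 1, Nat.sub_lt hd Nat.one_pos⟩]
  · simp [mul_comm]
  · intro s _ hs
    rw [if_neg fun h => hs (Fin.ext h), zero_mul]
  · simp

theorem Gmat_mulVec {n m p : ℕ} (li : Fin p → ℕ)
    (Φ : (i : Fin p) → Matrix (Fin (li i)) (Fin n) ℝ)
    (B : Matrix (Fin n) (Fin m) ℝ) (fc : (i : Fin p) → Fin (li i) → ℝ)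
    (u : Fin m → ℝ) (y : Fin p → ℝ) (i : Fin p) (r : Fin (li i)) :
    (Gmat li Φ B fc *ᵥ Sum.elim u y) ⟨i, r⟩ = ((Φ i * B) *ᵥ u + y i • fc i) r := by
  simp [Matrix.mulVec, dotProduct, Gmat, mul_comm]

end Shift

section Residue

variable {n : ℕ} {J K : Type*} [Fintype J] [Fintype K]

/-- The difference of two estimates of the same state obtained by left inverses is controlled by
the error of the partial observers. -/
theorem abs_estimate_sub_le {U : Matrix (Fin n) J ℝ} {V : Matrix (Fin n) K ℝ}
    {P : Matrix J (Fin n) ℝ} {Q : Matrix K (Fin n) ℝ} (hU : U * P = 1) (hV : V * Q = 1)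
    {c b : ℝ} (hUc : mnorm U ≤ c) (hVc : mnorm V ≤ c) (hb : 0 ≤ b)
    (x : Fin n → ℝ) {zU : J → ℝ} {zV : K → ℝ}
    (hzU : ∀ j, |(P *ᵥ x) j - zU j| ≤ b) (hzV : ∀ j, |(Q *ᵥ x) j - zV j| ≤ b) (i : Fin n) :
    |(U *ᵥ zU) i - (V *ᵥ zV) i| ≤ 2 * c * b := by
  have h1 := abs_mulVec_le U (w := P *ᵥ x - zU) hb hzU i
  have h2 := abs_mulVec_le V (w := Q *ᵥ x - zV) hb hzV i
  rw [Matrix.mulVec_sub, Matrix.mulVec_mulVec, hU, Matrix.one_mulVec, Pi.sub_apply] at h1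
  rw [Matrix.mulVec_sub, Matrix.mulVec_mulVec, hV, Matrix.one_mulVec, Pi.sub_apply] at h2
  have h3 := mul_le_mul_of_nonneg_right hUc hb
  have h4 := mul_le_mul_of_nonneg_right hVc hb
  rw [abs_le] at *
  constructor <;> linarith [h1.1, h1.2, h2.1, h2.2]

/-- Error of an estimate computed from a quantized left inverse and a quantized state. -/
theorem abs_quantized_estimate_sub_le {U : Matrix (Fin n) J ℝ} {c M E η s₁ s₂ : ℝ} {N : ℕ}
    (hU : mnorm U ≤ c) (hN : Fintype.card J ≤ N) (hM : 0 ≤ M) (hE : 0 ≤ E) (hs₁ : 0 < s₁)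
    (hs₁η : s₁ ≤ η) (hη : η ≤ 1) {zI : J → ℤ} {z : J → ℝ} (hz : ∀ j, |z j| ≤ M)
    (hzI : ∀ j, |s₁ * s₂ * (zI j : ℝ) - z j| ≤ E * η) (i : Fin n) :
    |s₁ ^ 2 * s₂ * (((roundMat fun i j => U i j / s₁) *ᵥ zI) i : ℝ) - (U *ᵥ z) i| ≤
      N * ((c + 1) * E + M) * η := by
  have h := abs_mulVec_sub_mulVec_le (η := η) (hs₁.le.trans hs₁η)
    (fun i j => (abs_le_mnorm U i j).trans hU) hz
    (W' := Matrix.of fun i j => s₁ * (round (U i j / s₁) : ℝ))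
    (fun i j => (abs_mul_round_div_sub_le hs₁ (U i j)).trans hs₁η) hzI i
  rw [← cast_roundMat_mulVec] at h
  have hη0 : 0 ≤ η := hs₁.le.trans hs₁η
  have hc : 0 ≤ c := (mnorm_nonneg U).trans hU
  calc _ = |s₁ * (s₁ * s₂) * (((roundMat fun i j => U i j / s₁) *ᵥ zI) i : ℝ) - (U *ᵥ z) i| := by
        rw [← mul_assoc s₁ s₁ s₂, ← sq]
    _ ≤ _ := h
    _ ≤ N * ((c + 1) * (E * η) + η * M) := by gcongr
    _ = _ := by ring

end Residue

theorem abs_integerState_sub_le {m p : ℕ} {li : Fin p → ℕ}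
    {G : Matrix (Σ i : Fin p, Fin (li i)) (Fin m ⊕ Fin p) ℝ}
    {v : ℕ → Fin m ⊕ Fin p → ℝ} {z : ℕ → (Σ i : Fin p, Fin (li i)) → ℝ}
    (hz : ∀ t i r, z (t + 1) ⟨i, r⟩ =
      (shiftM (li i) *ᵥ fun s => z t ⟨i, s⟩) r + (G *ᵥ v t) ⟨i, r⟩)
    {lmax : ℕ} (hl : ∀ i, li i ≤ lmax) {Mb η s₁ s₂ : ℝ} (hv : ∀ t j, |v t j| ≤ Mb)
    (hMb : 0 ≤ Mb) (hs₁ : 0 < s₁) (hs₂ : 0 < s₂) (hs₁η : s₁ ≤ η) (hs₂η : s₂ ≤ η) (hη : η ≤ 1)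
    (t : ℕ) (j : Σ i : Fin p, Fin (li i)) :
    |s₁ * s₂ * (integerState (sigmaShift li) (roundVec fun j => z 0 j / (s₁ * s₂))
        (fun t => (roundMat fun r c => G r c / s₁) *ᵥ roundVec fun c => v t c / s₂) t j : ℝ)
        - z t j| ≤
      (1 + lmax * (Fintype.card (Fin m ⊕ Fin p) * (mnorm G + 1 + Mb))) * η := by
  set zI := integerState (sigmaShift li) (roundVec fun j => z 0 j / (s₁ * s₂))
    (fun t => (roundMat fun r c => G r c / s₁) *ᵥ roundVec fun c => v t c / s₂) with hzI
  obtain ⟨i, r⟩ := j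
  have hη0 : 0 ≤ η := hs₁.le.trans hs₁η
  have hG := mnorm_nonneg G
  have hw : ∀ t r, |s₁ * s₂ * (((roundMat fun r c => G r c / s₁) *ᵥ
      roundVec fun c => v t c / s₂) ⟨i, r⟩ : ℝ) - (G *ᵥ v t) ⟨i, r⟩| ≤
      Fintype.card (Fin m ⊕ Fin p) * (mnorm G + 1 + Mb) * η := by
    intro t r
    rw [cast_roundMat_mulVec]
    refine (abs_mulVec_sub_mulVec_le hη0 (abs_le_mnorm G) (hv t)
      (fun i j => (abs_mul_round_div_sub_le hs₁ (G i j)).trans hs₁η)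
      (fun j => (abs_mul_round_div_sub_le hs₂ (v t j)).trans hs₂η) _).trans ?_
    calc (Fintype.card (Fin m ⊕ Fin p) : ℝ) * ((mnorm G + η) * η + η * Mb)
        ≤ Fintype.card (Fin m ⊕ Fin p) * ((mnorm G + 1) * η + η * Mb) := by gcongr
      _ = _ := by ring
  have h0 : ∀ r, |s₁ * s₂ * (zI 0 ⟨i, r⟩ : ℝ) - z 0 ⟨i, r⟩| ≤ η := fun r =>
    (abs_mul_round_div_sub_le (mul_pos hs₁ hs₂) (z 0 ⟨i, r⟩)).trans
      (by nlinarith)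
  have h := shift_trajectory_abs_le (e := fun t r => s₁ * s₂ * (zI t ⟨i, r⟩ : ℝ) - z t ⟨i, r⟩)
    hη0 (fun t r => ?_) h0 hw t r
  · refine h.trans ?_
    have hr : ((r : ℕ) : ℝ) + 1 ≤ lmax := by
      exact_mod_cast (Nat.succ_le_of_lt r.2).trans (hl i)
    calc η + ((r : ℕ) + 1) * (Fintype.card (Fin m ⊕ Fin p) * (mnorm G + 1 + Mb) * η)
        ≤ η + lmax * (Fintype.card (Fin m ⊕ Fin p) * (mnorm G + 1 + Mb) * η) := by gcongr
      _ = _ := by ring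
  · have hstep : zI (t + 1) = sigmaShift li *ᵥ zI t +
      (roundMat fun r c => G r c / s₁) *ᵥ roundVec fun c => v t c / s₂ := rfl
    have hlin : (shiftM (li i) *ᵥ fun r => s₁ * s₂ * (zI t ⟨i, r⟩ : ℝ) - z t ⟨i, r⟩) r =
        s₁ * s₂ * (shiftM (li i) *ᵥ fun s => (zI t ⟨i, s⟩ : ℝ)) r
          - (shiftM (li i) *ᵥ fun s => z t ⟨i, s⟩) r := by
      simp only [shiftM_mulVec_apply]
      split_ifs <;> ring
    simp only [hlin, hz, hstep, Pi.add_apply, Int.cast_add, cast_sigmaShift_mulVec]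
    ring

/-- Theorem 1, part 1 (attack detection over `ℤ_q`): for any `ε > 0` there exist
`s1' > 0` and `s2' > 0` such that for all `s1 < s1'`, `s2 < s2'` and every modulus
`q > 2(κ(M + 2 z̃_ini) + 2ε)/(s1² s2)`, if the inequality
`‖s1² s2 · r̄(t)‖ ≤ 2 κ z̃_ini 1_{t<l_max} + ε` is violated for some `t`, then the
attack signal is not identically zero (`I ≠ [p]`). -/
theorem stmt0 (n m p k : ℕ) (hk : k < p)
    (A : Matrix (Fin n) (Fin n) ℝ) (B : Matrix (Fin n) (Fin m) ℝ)
    (C : Matrix (Fin p) (Fin n) ℝ)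
    (x : ℕ → Fin n → ℝ) (u : ℕ → Fin m → ℝ) (y a : ℕ → Fin p → ℝ)
    (hx : ∀ t, x (t + 1) = A.mulVec (x t) + B.mulVec (u t))
    (hy : ∀ t, y t = C.mulVec (x t) + a t)
    -- u and y remain bounded when there is no attack
    (hbnd : (∀ t i, a t i = 0) → ∃ Mb : ℝ, ∀ t, vnorm (u t) ≤ Mb ∧ vnorm (y t) ≤ Mb)
    (li : Fin p → ℕ) (hli : ∀ i, 0 < li i)
    (Φ : (i : Fin p) → Matrix (Fin (li i)) (Fin n) ℝ)
    (hΦrow : ∀ i, LinearIndependent ℝ (fun r : Fin (li i) => Φ i r))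
    (fc : (i : Fin p) → Fin (li i) → ℝ)
    (hΦA : ∀ i, Φ i * A = canonF (fc i) * Φ i)
    (hC : ∀ i, C i = Φ i ⟨li i - 1, Nat.sub_lt (hli i) Nat.one_pos⟩)
    (zh : (i : Fin p) → ℕ → Fin (li i) → ℝ)
    (hobs : ∀ i t, zh i (t + 1) =
      (shiftM (li i)).mulVec (zh i t) + (Φ i * B).mulVec (u t) + y t i • fc i)
    -- fixed left inverses Φ† and Φ_Λ†
    (Φdag : Matrix (Fin n) (Σ i : Fin p, Fin (li i)) ℝ)
    (hΦdag : Φdag * Matrix.of (fun (j : Σ i : Fin p, Fin (li i)) c => Φ j.1 j.2 c) = 1)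
    (ΦdagΛ : (Λ : Finset (Fin p)) →
      Matrix (Fin n) {j : Σ i : Fin p, Fin (li i) // j.1 ∈ Λ} ℝ)
    (hΦdagΛ : ∀ Λ : Finset (Fin p), Λ.card = p - k →
      ΦdagΛ Λ * Matrix.of
        (fun (j : {j : Σ i : Fin p, Fin (li i) // j.1 ∈ Λ}) c => Φ j.1.1 j.1.2 c) = 1)
    (κ : ℝ)
    (hκ : κ = max (mnorm Φdag)
      (sSup {r : ℝ | ∃ Λ : Finset (Fin p), Λ.card = p - k ∧ r = mnorm (ΦdagΛ Λ)}))
    (lmax : ℕ) (hlmax : lmax = Finset.univ.sup li)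
    (ztil : ℝ)
    (hztil : ztil = sSup (Set.range fun i : Fin p =>
      vnorm (fun j => (Φ i).mulVec (x 0) j - zh i 0 j)))
    -- the bound M on the attack-free residue and observer state
    (M : ℝ) (hM : 0 < M)
    (hMbound : (∀ t i, a t i = 0) → ∀ t,
      vnorm (fun ji : {Λ : Finset (Fin p) // Λ.card = p - k} × Fin n =>
          (ΦdagΛ ji.1.1).mulVec (fun jj => zh jj.1.1 t jj.1.2) ji.2
            - Φdag.mulVec (fun jj => zh jj.1 t jj.2) ji.2) ≤ M ∧
        vnorm (fun j : Σ i : Fin p, Fin (li i) => zh j.1 t j.2) ≤ M) :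
    ∀ ε : ℝ, 0 < ε →
      ∃ s1' : ℝ, 0 < s1' ∧ ∃ s2' : ℝ, 0 < s2' ∧
        ∀ s1 s2 : ℝ, 0 < s1 → s1 ≤ 1 → s1 < s1' → 0 < s2 → s2 < s2' →
          ∀ q : ℕ, 2 * (κ * (M + 2 * ztil) + 2 * ε) / (s1 ^ 2 * s2) < (q : ℝ) →
            -- the quantized observer over ℤ_q
            ∀ zb : ℕ → (Σ i : Fin p, Fin (li i)) → ℤ,
              zb 0 = cmodv (roundVec (fun j => zh j.1 0 j.2 / (s1 * s2))) q →
              (∀ t, zb (t + 1) = cmodv ((sigmaShift li).mulVec (zb t)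
                  + (roundMat (fun r c => Gmat li Φ B fc r c / s1)).mulVec
                      (roundVec (fun c => Sum.elim (u t) (y t) c / s2))) q) →
            ∀ xb : ℕ → Fin n → ℤ,
              (∀ t, xb t = cmodv ((roundMat (fun i j => Φdag i j / s1)).mulVec (zb t)) q) →
            ∀ xbΛ : (Λ : Finset (Fin p)) → ℕ → Fin n → ℤ,
              (∀ Λ t, xbΛ Λ t = cmodv ((roundMat
                  (fun i (j : {j : Σ i : Fin p, Fin (li i) // j.1 ∈ Λ}) =>
                    ΦdagΛ Λ i j / s1)).mulVec (fun jj => zb t jj.1)) q) →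
              -- if the residue inequality is violated at some time t …
              (∃ t, ¬ (vnorm (fun ji : {Λ : Finset (Fin p) // Λ.card = p - k} × Fin n =>
                  s1 ^ 2 * s2 * ((cmod (xbΛ ji.1.1 t ji.2 - xb t ji.2) q : ℤ) : ℝ)) ≤
                2 * κ * ztil * (if t < lmax then 1 else 0) + ε)) →
              -- … then the attack is not identically zero
              ¬ (∀ t i, a t i = 0) := by
  intro ε hε
  by_cases ha : ∀ t i, a t i = 0
  swap
  · exact ⟨1, one_pos, 1, one_pos, fun _ _ _ _ _ _ _ _ _ _ _ _ _ _ _ _ _ => ha⟩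
  obtain ⟨Mb', hMb'⟩ := hbnd ha
  have hMb : 0 ≤ Mb' := (vnorm_nonneg _).trans (hMb' 0).1
  have hMz : ∀ t (j : Σ i : Fin p, Fin (li i)), |zh j.1 t j.2| ≤ M := fun t j =>
    (abs_le_vnorm (fun j : Σ i : Fin p, Fin (li i) => zh j.1 t j.2) j).trans (hMbound ha t).2
  have hκ1 : mnorm Φdag ≤ κ := hκ ▸ le_max_left _ _
  have hκ2 : ∀ Λ : Finset (Fin p), Λ.card = p - k → mnorm (ΦdagΛ Λ) ≤ κ := fun Λ hΛ => by
    refine hκ ▸ le_max_of_le_right (le_csSup (Set.Finite.bddAbove ?_) ⟨Λ, hΛ, rfl⟩)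
    refine (Set.finite_range fun Λ => mnorm (ΦdagΛ Λ)).subset ?_
    rintro _ ⟨Λ, -, rfl⟩
    exact ⟨Λ, rfl⟩
  have hκ0 : 0 ≤ κ := (mnorm_nonneg _).trans hκ1
  have hl : ∀ i, li i ≤ lmax := fun i => hlmax ▸ Finset.le_sup (Finset.mem_univ i)
  have hztil0 : 0 ≤ ztil := hztil ▸ Real.sSup_nonneg (by
    rintro _ ⟨i, rfl⟩; exact vnorm_nonneg _)
  have herr : ∀ t i r, (Φ i *ᵥ x (t + 1)) r - zh i (t + 1) r =
      (shiftM (li i) *ᵥ fun s => (Φ i *ᵥ x t) s - zh i t s) r := by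
    intro t i r
    have hyi : y t i = (Φ i *ᵥ x t) ⟨li i - 1, Nat.sub_lt (hli i) Nat.one_pos⟩ := by
      rw [hy, Pi.add_apply, ha, add_zero]
      exact congrArg (· ⬝ᵥ x t) (hC i)
    have hlin : (shiftM (li i) *ᵥ fun s => (Φ i *ᵥ x t) s - zh i t s) =
        shiftM (li i) *ᵥ (Φ i *ᵥ x t) - shiftM (li i) *ᵥ zh i t := Matrix.mulVec_sub _ _ _
    rw [hlin, hobs, hx, Matrix.mulVec_add, Matrix.mulVec_mulVec, hΦA, ← Matrix.mulVec_mulVec,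
      canonF_mulVec (hli i), hyi, Matrix.mulVec_mulVec (u t)]
    simp only [Pi.add_apply, Pi.sub_apply]
    ring
  have hinit : ∀ i r, |(Φ i *ᵥ x 0) r - zh i 0 r| ≤ ztil := fun i r => by
    refine (abs_le_vnorm (fun j => (Φ i).mulVec (x 0) j - zh i 0 j) r).trans ?_
    rw [hztil]
    exact le_csSup (Set.finite_range _).bddAbove ⟨i, rfl⟩
  have hzt : ∀ t i r, |(Φ i *ᵥ x t) r - zh i t r| ≤ ztil * (if t < lmax then 1 else 0) := by
    intro t i r
    split_ifs with ht
    · simpa using shift_trajectory_abs_le (e := fun t r => (Φ i *ᵥ x t) r - zh i t r)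
        (w := fun _ _ => 0) (δ := 0) hztil0 (fun t r => by simpa using herr t i r)
        (hinit i) (by simp) t r
    · rw [shift_trajectory_eq_zero (e := fun t r => (Φ i *ᵥ x t) r - zh i t r)
        (fun t r => herr t i r) t r (by have := hl i; omega)]
      simp
  set G := Gmat li Φ B fc with hGdef
  set E : ℝ := 1 + lmax * (Fintype.card (Fin m ⊕ Fin p) * (mnorm G + 1 + Mb')) with hEdef
  have hE : 0 ≤ E := by have := mnorm_nonneg G; positivity
  set H : ℝ := Fintype.card (Σ i : Fin p, Fin (li i)) * ((κ + 1) * E + M) with hHdef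
  have hH : 0 ≤ H := by positivity
  set η : ℝ := min 1 (ε / (2 * H + 1)) with hηdef
  have hη : 0 < η := lt_min one_pos (by positivity)
  have hη1 : η ≤ 1 := min_le_left _ _
  have hηε : 2 * (H * η) ≤ ε := by
    have h1 : η ≤ ε / (2 * H + 1) := min_le_right _ _
    rw [le_div_iff₀ (by positivity)] at h1
    nlinarith
  refine ⟨η, hη, η, hη, ?_⟩
  intro s1 s2 hs1 _ hs1η hs2 hs2η q hq zb hzb0 hzb xb hxb xbΛ hxbΛ ⟨t, ht⟩
  refine absurd ?_ ht
  set zI := integerState (sigmaShift li)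
    (roundVec fun j : Σ i : Fin p, Fin (li i) => zh j.1 0 j.2 / (s1 * s2))
    (fun t => (roundMat fun r c => G r c / s1) *ᵥ
      roundVec fun c => Sum.elim (u t) (y t) c / s2) with hzIdef
  have hmod : ∀ j, zb t j ≡ zI t j [ZMOD q] := modEq_integerState hzb0 hzb t
  have hzI : ∀ j, |s1 * s2 * (zI t j : ℝ) - zh j.1 t j.2| ≤ E * η :=
    abs_integerState_sub_le (z := fun t (j : Σ i : Fin p, Fin (li i)) => zh j.1 t j.2)
      (fun t i r => by
        rw [Gmat_mulVec, hobs]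
        simp only [Pi.add_apply]
        ring)
      hl (fun t j => by
        rcases j with j | j
        · exact (abs_le_vnorm (u t) j).trans (hMb' t).1
        · exact (abs_le_vnorm (y t) j).trans (hMb' t).2)
      hMb hs1 hs2 hs1η.le hs2η.le hη1 t
  have hbound : 0 ≤ 2 * κ * ztil * (if t < lmax then 1 else 0) := by
    split_ifs <;> positivity
  refine vnorm_le (by linarith) ?_
  rintro ⟨⟨Λ, hΛ⟩, i⟩
  set rΛ := ((roundMat fun i (j : {j : Σ i : Fin p, Fin (li i) // j.1 ∈ Λ}) =>
    ΦdagΛ Λ i j / s1) *ᵥ fun jj => zI t jj.1) i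
  set r := ((roundMat fun i j => Φdag i j / s1) *ᵥ zI t) i
  have hres : |s1 ^ 2 * s2 * ((rΛ - r : ℤ) : ℝ)| ≤
      2 * κ * ztil * (if t < lmax then 1 else 0) + ε := by
    have h1 := abs_quantized_estimate_sub_le (hκ2 Λ hΛ) (Fintype.card_subtype_le _) hM.le hE hs1
      hs1η.le hη1 (fun jj => hMz t jj.1) (fun jj => hzI jj.1) i
    have h2 := abs_quantized_estimate_sub_le hκ1 le_rfl hM.le hE hs1 hs1η.le hη1 (hMz t) hzI i
    have h3 := abs_estimate_sub_le (hΦdagΛ Λ hΛ) hΦdag (hκ2 Λ hΛ) hκ1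
      (by split_ifs <;> simp [hztil0] : 0 ≤ ztil * (if t < lmax then (1 : ℝ) else 0)) (x t)
      (zU := fun jj : {j : Σ i : Fin p, Fin (li i) // j.1 ∈ Λ} => zh jj.1.1 t jj.1.2)
      (zV := fun jj : Σ i : Fin p, Fin (li i) => zh jj.1 t jj.2)
      (fun jj => hzt t jj.1.1 jj.1.2) (fun jj => hzt t jj.1 jj.2) i
    rw [← mul_assoc] at h3
    push_cast
    rw [mul_sub]
    rw [abs_le] at *
    constructor <;> linarith [h1.1, h1.2, h2.1, h2.2, h3.1, h3.2]
  have hsmall : 2 * |rΛ - r| < (q : ℤ) := by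
    have hs : 0 < s1 ^ 2 * s2 := by positivity
    have hle : 2 * κ * ztil * (if t < lmax then 1 else 0) ≤ 2 * κ * ztil := by
      refine mul_le_of_le_one_right (by positivity) ?_
      split_ifs <;> norm_num
    rw [div_lt_iff₀ hs] at hq
    rw [abs_mul, abs_of_pos hs] at hres
    have hκM : 0 ≤ κ * M := by positivity
    have h : (s1 ^ 2 * s2) * (2 * |((rΛ - r : ℤ) : ℝ)|) < (s1 ^ 2 * s2) * q := by
      linarith
    exact_mod_cast lt_of_mul_lt_mul_left h hs.le
  have hcmod : cmod (xbΛ Λ t i - xb t i) q = rΛ - r := by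
    refine cmod_eq_of_modEq (Int.ModEq.sub ?_ ?_) hsmall
    · rw [hxbΛ]
      exact (cmod_modEq _ _).trans (mulVec_modEq _
        (fun jj : {j : Σ i : Fin p, Fin (li i) // j.1 ∈ Λ} => hmod jj.1) i)
    · rw [hxb]
      exact (cmod_modEq _ _).trans (mulVec_modEq _ hmod i)
  simpa only [hcmod] using hres
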